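/- arXiv:2604.15856 — 3 statements merged into one kernel-verified Lean document; each statement's English description precedes it below -/
import Mathlib

section
/- Let M ≥ 1 and let X₁, …, X_M and Y be random variables on a common probability space taking values in finite nonempty measurable spaces. For each i let g_i be a measurable map on the value space of X_i and set Z_i = g_i(X_i). If the encoded features are perfectly aligned, i.e. Z₁ = Z₂ = ⋯ = Z_M almost surely (with all Z_i taking values in the same finite space), then the conditional-entropy gap satisfies H(Y | (Z₁,…,Z_M)) − H(Y | (X₁,…,X_M)) ≥ max_{1≤i≤M} I(X_i;Y) − min_{1≤i≤M} I(X_i;Y). -/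
open MeasureTheory ProbabilityTheory Real ENNReal

namespace Paper

variable {Ω : Type*} [MeasurableSpace Ω]

/-- Shannon entropy (natural log) of a finitely-valued random variable `X` under `μ`. -/
noncomputable def entropy {S : Type*} [Fintype S] [MeasurableSpace S]
    (X : Ω → S) (μ : Measure Ω) : ℝ :=
  ∑ s : S, Real.negMulLog ((μ.map X) {s}).toReal

/-- Shannon conditional entropy `H(Y | X)`:
the average over the values `s` of `X` of the entropy of `Y` under the
conditional measure `μ[|X ⁻¹' {s}]`. -/
noncomputable def condEntropy {S T : Type*} [Fintype S] [MeasurableSpace S]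
    [Fintype T] [MeasurableSpace T]
    (Y : Ω → T) (X : Ω → S) (μ : Measure Ω) : ℝ :=
  ∑ s : S, ((μ.map X) {s}).toReal * entropy Y (ProbabilityTheory.cond μ (X ⁻¹' {s}))

/-- Shannon mutual information `I(X ; Y) = H(Y) - H(Y | X)`. -/
noncomputable def mutualInfo {S T : Type*} [Fintype S] [MeasurableSpace S]
    [Fintype T] [MeasurableSpace T]
    (X : Ω → S) (Y : Ω → T) (μ : Measure Ω) : ℝ :=
  entropy Y μ - condEntropy Y X μ

lemma jensen_negMulLog {S : Type*} (F : Finset S) (p a : S → ℝ)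
    (ha : ∀ s, 0 ≤ a s) (hap : ∀ s, a s ≤ p s) :
    ∑ s ∈ F, p s * negMulLog (a s / p s)
      ≤ (∑ s ∈ F, p s) * negMulLog ((∑ s ∈ F, a s) / ∑ s ∈ F, p s) := by
  have hp : ∀ s, 0 ≤ p s := fun s => (ha s).trans (hap s)
  rcases (Finset.sum_nonneg (fun s (_ : s ∈ F) => hp s)).eq_or_lt with h | h
  · rw [← h, zero_mul]
    have h0 := (Finset.sum_eq_zero_iff_of_nonneg (fun s _ => hp s)).1 h.symm
    exact (Finset.sum_eq_zero fun s hs => by rw [h0 s hs, zero_mul]).le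
  · set q := ∑ s ∈ F, p s with hq
    have key := Real.concaveOn_negMulLog.le_map_sum (t := F) (w := fun s => p s / q)
      (p := fun s => a s / p s) (fun s _ => div_nonneg (hp s) h.le)
      (by rw [← Finset.sum_div, ← hq, div_self h.ne'])
      (fun s _ => div_nonneg (ha s) (hp s))
    simp only [smul_eq_mul] at key
    have e1 : ∑ s ∈ F, p s / q * (a s / p s) = (∑ s ∈ F, a s) / q := by
      rw [Finset.sum_div]
      refine Finset.sum_congr rfl fun s _ => ?_
      rcases (hp s).eq_or_lt with h0 | h0
      · have : a s = 0 := le_antisymm (by rw [h0]; exact hap s) (ha s)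
        simp [this]
      · field_simp
    rw [e1] at key
    have := mul_le_mul_of_nonneg_left key h.le
    rw [Finset.mul_sum] at this
    refine le_trans (le_of_eq (Finset.sum_congr rfl fun s _ => ?_)) this
    field_simp

lemma condEntropy_eq {S T : Type*} [Fintype S] [MeasurableSpace S] [MeasurableSingletonClass S]
    [Fintype T] [MeasurableSpace T] [MeasurableSingletonClass T]
    (Y : Ω → T) (X : Ω → S) (μ : Measure Ω) (hX : Measurable X) (hY : Measurable Y) :
    condEntropy Y X μ = ∑ t : T, ∑ s : S, μ.real (X ⁻¹' {s}) *
      negMulLog (μ.real (X ⁻¹' {s} ∩ Y ⁻¹' {t}) / μ.real (X ⁻¹' {s})) := by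
  unfold condEntropy entropy
  rw [Finset.sum_comm]
  refine Finset.sum_congr rfl fun s _ => ?_
  rw [Finset.mul_sum]
  refine Finset.sum_congr rfl fun t _ => ?_
  rw [Measure.map_apply hX (measurableSet_singleton s),
    Measure.map_apply hY (measurableSet_singleton t),
    ProbabilityTheory.cond_apply (hX (measurableSet_singleton s)), ENNReal.toReal_mul,
    ENNReal.toReal_inv, div_eq_inv_mul]
  rfl

lemma condEntropy_le_of_ae_eq_comp {S T U : Type*}
    [Fintype S] [MeasurableSpace S] [MeasurableSingletonClass S]
    [Fintype T] [MeasurableSpace T] [MeasurableSingletonClass T]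
    [Fintype U] [MeasurableSpace U] [MeasurableSingletonClass U]
    (Y : Ω → T) (V : Ω → S) (W : Ω → U) (f : S → U) (μ : Measure Ω) [IsProbabilityMeasure μ]
    (hY : Measurable Y) (hV : Measurable V) (hW : Measurable W)
    (h : W =ᵐ[μ] fun ω => f (V ω)) :
    condEntropy Y V μ ≤ condEntropy Y W μ := by
  classical
  have fib : ∀ (u : U) (B : Set Ω), MeasurableSet B → μ.real (W ⁻¹' {u} ∩ B) =
      ∑ s ∈ Finset.univ.filter (fun s => f s = u), μ.real (V ⁻¹' {s} ∩ B) := by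
    intro u B hB
    rw [← measureReal_biUnion_finset]
    · apply measureReal_congr
      filter_upwards [h] with ω hω
      apply propext
      change ω ∈ W ⁻¹' {u} ∩ B ↔
        ω ∈ ⋃ s ∈ Finset.univ.filter (fun s => f s = u), V ⁻¹' {s} ∩ B
      simp [hω]
    · intro s _ s' _ hs
      refine Set.disjoint_left.2 fun ω h1 h2 => hs ?_
      exact h1.1.symm.trans h2.1
    · intro s _
      exact (hV (measurableSet_singleton s)).inter hB
  have fib' : ∀ u : U, μ.real (W ⁻¹' {u}) =
      ∑ s ∈ Finset.univ.filter (fun s => f s = u), μ.real (V ⁻¹' {s}) := by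
    intro u
    simpa using fib u Set.univ MeasurableSet.univ
  rw [condEntropy_eq Y V μ hV hY, condEntropy_eq Y W μ hW hY]
  refine Finset.sum_le_sum fun t _ => ?_
  rw [← Finset.sum_fiberwise (s := Finset.univ) (g := f)]
  refine Finset.sum_le_sum fun u _ => ?_
  rw [fib u _ (hY (measurableSet_singleton t)), fib' u]
  exact jensen_negMulLog _ (fun s => μ.real (V ⁻¹' {s}))
    (fun s => μ.real (V ⁻¹' {s} ∩ Y ⁻¹' {t})) (fun s => measureReal_nonneg)
    (fun s => measureReal_mono Set.inter_subset_left)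

/-- If the encoded features `Z i = g i ∘ X i` are perfectly aligned
almost surely, then the conditional-entropy gap
`H(Y | (Z₁,…,Z_M)) − H(Y | (X₁,…,X_M))` is at least
`max_i I(X i ; Y) − min_i I(X i ; Y)`. -/
theorem conditional_entropy_gap_of_aligned
    (μ : Measure Ω) [IsProbabilityMeasure μ]
    {M : ℕ} (hM : 1 ≤ M)
    {𝒳 : Fin M → Type*} [∀ i, Fintype (𝒳 i)] [∀ i, Nonempty (𝒳 i)]
    [∀ i, MeasurableSpace (𝒳 i)] [∀ i, DiscreteMeasurableSpace (𝒳 i)]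
    {𝒴 : Type*} [Fintype 𝒴] [Nonempty 𝒴] [MeasurableSpace 𝒴] [DiscreteMeasurableSpace 𝒴]
    {𝒵 : Type*} [Fintype 𝒵] [Nonempty 𝒵] [MeasurableSpace 𝒵] [DiscreteMeasurableSpace 𝒵]
    (X : ∀ i, Ω → 𝒳 i) (Y : Ω → 𝒴) (g : ∀ i, 𝒳 i → 𝒵)
    (hX : ∀ i, Measurable (X i)) (hY : Measurable Y) (hg : ∀ i, Measurable (g i))
    (halign : ∀ i j, (fun ω => g i (X i ω)) =ᵐ[μ] (fun ω => g j (X j ω))) :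
    condEntropy Y (fun ω => fun i => g i (X i ω)) μ
        - condEntropy Y (fun ω => fun i => X i ω) μ
      ≥ Finset.univ.sup' ⟨⟨0, hM⟩, Finset.mem_univ _⟩ (fun i => mutualInfo (X i) Y μ)
        - Finset.univ.inf' ⟨⟨0, hM⟩, Finset.mem_univ _⟩ (fun i => mutualInfo (X i) Y μ) := by
  obtain ⟨i, -, hi⟩ := Finset.exists_mem_eq_sup' (s := Finset.univ)
    ⟨⟨0, hM⟩, Finset.mem_univ _⟩ (fun i => mutualInfo (X i) Y μ)
  obtain ⟨j, -, hj⟩ := Finset.exists_mem_eq_inf' (s := Finset.univ)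
    ⟨⟨0, hM⟩, Finset.mem_univ _⟩ (fun i => mutualInfo (X i) Y μ)
  rw [hi, hj]
  have h1 : condEntropy Y (fun ω => fun i => X i ω) μ ≤ condEntropy Y (X i) μ :=
    condEntropy_le_of_ae_eq_comp Y _ _ (fun x => x i) μ hY (measurable_pi_lambda _ hX) (hX i)
      (Filter.EventuallyEq.refl _ _)
  have h2 : condEntropy Y (X j) μ ≤ condEntropy Y (fun ω => fun i => g i (X i ω)) μ := by
    refine condEntropy_le_of_ae_eq_comp Y _ _ (fun x _ => g j x) μ hY (hX j)
      (measurable_pi_lambda _ fun k => (hg k).comp (hX k)) ?_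
    filter_upwards [MeasureTheory.ae_all_iff.2 fun k => halign k j] with ω hω
    funext k
    exact hω k
  simp only [mutualInfo]
  linarith

end Paper
end

section
/- (Conditional entropy as optimal expected log-loss, as used in the paper's proof.) Let X and Y be random variables on a common probability space taking values in finite nonempty measurable spaces 𝒳 and 𝒴. For a predictor h : 𝒳 → PMF(𝒴) define its expected cross-entropy loss L(h) = E[ −log (h(X)) (Y) ] with values in [0, ∞] (where −log 0 = +∞). Then the infimum of L(h) over all predictors h equals the conditional entropy: inf_h L(h) = H(Y | X). -/
open MeasureTheory ProbabilityTheory Real ENNReal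

namespace Paper

variable {Ω : Type*} [MeasurableSpace Ω]

/-- Negative logarithm on `ℝ≥0∞`, with `-log 0 = ⊤`, valued in `[0, ∞]`.
(For `p ≤ 1` this is the usual log-loss `-log p`.) -/
noncomputable def negLog (p : ℝ≥0∞) : ℝ≥0∞ :=
  if p = 0 then ⊤ else ENNReal.ofReal (-Real.log p.toReal)

/-- Expected cross-entropy (log-loss) of a predictor `h : 𝒲 → PMF 𝒴` that predicts
the target `Y` from the random variable `W`, under `μ`. -/
noncomputable def crossEntropyLoss {W T : Type*} [MeasurableSpace W] [MeasurableSpace T]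
    (W' : Ω → W) (Y : Ω → T) (h : W → PMF T) (μ : Measure Ω) : ℝ≥0∞ :=
  ∫⁻ ω, negLog ((h (W' ω)) (Y ω)) ∂μ

lemma pmf_toReal_sum {T : Type*} [Fintype T] (q : PMF T) : ∑ y, (q y).toReal = 1 := by
  rw [← ENNReal.toReal_sum (fun y _ => q.apply_ne_top y), ← tsum_fintype (L := .unconditional T), q.tsum_coe]
  simp

lemma mul_negLog_of_ne {a b : ℝ≥0∞} (ha : a ≠ ⊤) (hb : b ≤ 1) (h : b = 0 → a = 0) :
    a * negLog b = ENNReal.ofReal (a.toReal * (-Real.log b.toReal)) := by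
  unfold negLog
  split_ifs with hb0
  · simp [h hb0]
  · rw [ENNReal.ofReal_mul ENNReal.toReal_nonneg, ENNReal.ofReal_toReal ha]

lemma neg_log_nonneg_of_le_one {b : ℝ≥0∞} (hb : b ≤ 1) : 0 ≤ -Real.log b.toReal := by
  have : b.toReal ≤ 1 := by simpa using ENNReal.toReal_mono ENNReal.one_ne_top hb
  linarith [Real.log_nonpos ENNReal.toReal_nonneg this]

lemma sum_mul_negLog {T : Type*} [Fintype T] (r q : PMF T) (h : ∀ y, q y = 0 → r y = 0) :
    ∑ y, r y * negLog (q y) = ENNReal.ofReal (∑ y, (r y).toReal * (-Real.log (q y).toReal)) := by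
  rw [ENNReal.ofReal_sum_of_nonneg]
  · exact Finset.sum_congr rfl fun y _ =>
      mul_negLog_of_ne (r.apply_ne_top y) (q.coe_le_one y) (h y)
  · intro y _
    exact mul_nonneg ENNReal.toReal_nonneg (neg_log_nonneg_of_le_one (q.coe_le_one y))

lemma sum_mul_negLog_self {T : Type*} [Fintype T] (r : PMF T) :
    ∑ y, r y * negLog (r y) = ENNReal.ofReal (∑ y, Real.negMulLog (r y).toReal) := by
  rw [sum_mul_negLog r r (fun _ h => h)]
  simp [Real.negMulLog]

lemma gibbs_term {a b : ℝ} (ha : 0 ≤ a) (hb : 0 ≤ b) (h : b = 0 → a = 0) :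
    Real.negMulLog a ≤ a * (-Real.log b) + (b - a) := by
  rcases ha.eq_or_lt with rfl | ha
  · simpa using hb
  have hb' : 0 < b := hb.lt_of_ne fun h0 => ha.ne' (h h0.symm)
  have h1 := Real.log_le_sub_one_of_pos (div_pos hb' ha)
  rw [Real.log_div hb'.ne' ha.ne'] at h1
  have h2 := mul_le_mul_of_nonneg_left h1 ha.le
  have h3 : a * (b / a - 1) = b - a := by field_simp
  rw [h3] at h2
  unfold Real.negMulLog
  linarith

lemma gibbs {T : Type*} [Fintype T] (r q : PMF T) :
    ENNReal.ofReal (∑ y, Real.negMulLog (r y).toReal) ≤ ∑ y, r y * negLog (q y) := by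
  by_cases h : ∀ y, q y = 0 → r y = 0
  · rw [sum_mul_negLog r q h]
    apply ENNReal.ofReal_le_ofReal
    have : ∑ y, Real.negMulLog (r y).toReal ≤
        ∑ y, ((r y).toReal * (-Real.log (q y).toReal) + ((q y).toReal - (r y).toReal)) := by
      refine Finset.sum_le_sum fun y _ => gibbs_term ENNReal.toReal_nonneg ENNReal.toReal_nonneg ?_
      intro h0
      have := (ENNReal.toReal_eq_zero_iff _).1 h0
      simp [h y (this.resolve_right (q.apply_ne_top y))]
    rw [Finset.sum_add_distrib, Finset.sum_sub_distrib, pmf_toReal_sum, pmf_toReal_sum] at this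
    linarith
  · push Not at h
    obtain ⟨y, hq, hr⟩ := h
    have : ∑ y, r y * negLog (q y) = ⊤ := by
      apply ENNReal.sum_eq_top.2
      exact ⟨y, Finset.mem_univ _, by simp [negLog, hq, ENNReal.mul_top hr]⟩
    simp [this]

section
variable (μ : Measure Ω) [IsProbabilityMeasure μ]
    {S : Type*} [Fintype S] [MeasurableSpace S] [DiscreteMeasurableSpace S]
    {T : Type*} [Fintype T] [Nonempty T] [MeasurableSpace T] [DiscreteMeasurableSpace T]

/-- The conditional law of `Y` given `X = x` (arbitrary on null events). -/
lemma exists_cond_pmf (X : Ω → S) (Y : Ω → T) (hX : Measurable X) (hY : Measurable Y) (x : S) :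
    ∃ r : PMF T, μ (X ⁻¹' {x}) ≠ 0 →
      ∀ y, r y = ((ProbabilityTheory.cond μ (X ⁻¹' {x})).map Y) {y} := by
  by_cases h : μ (X ⁻¹' {x}) = 0
  · exact ⟨PMF.pure (Classical.arbitrary T), fun h' => absurd h h'⟩
  · have := ProbabilityTheory.cond_isProbabilityMeasure h
    have := Measure.isProbabilityMeasure_map (μ := ProbabilityTheory.cond μ (X ⁻¹' {x})) hY.aemeasurable
    exact ⟨((ProbabilityTheory.cond μ (X ⁻¹' {x})).map Y).toPMF, fun _ y => rfl⟩

lemma crossEntropyLoss_eq (X : Ω → S) (Y : Ω → T) (hX : Measurable X) (hY : Measurable Y)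
    (h : S → PMF T) (r : S → PMF T) (hr : ∀ x, μ (X ⁻¹' {x}) ≠ 0 →
      ∀ y, r x y = ((ProbabilityTheory.cond μ (X ⁻¹' {x})).map Y) {y}) :
    crossEntropyLoss X Y h μ = ∑ x, μ (X ⁻¹' {x}) * ∑ y, r x y * negLog (h x y) := by
  have h1 : crossEntropyLoss X Y h μ =
      ∫⁻ z, negLog (h z.1 z.2) ∂(μ.map fun ω => (X ω, Y ω)) := by
    rw [lintegral_map (Measurable.of_discrete) (hX.prodMk hY)]
    rfl
  rw [h1, lintegral_fintype, Fintype.sum_prod_type]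
  refine Finset.sum_congr rfl fun x _ => ?_
  rw [Finset.mul_sum]
  refine Finset.sum_congr rfl fun y _ => ?_
  rw [Measure.map_apply (hX.prodMk hY) (measurableSet_singleton _), mul_comm, ← mul_assoc]
  congr 1
  have hpre : (fun ω => (X ω, Y ω)) ⁻¹' {(x, y)} = X ⁻¹' {x} ∩ Y ⁻¹' {y} := by
    ext ω; simp
  rw [hpre]
  by_cases h0 : μ (X ⁻¹' {x}) = 0
  · rw [h0, zero_mul]
    exact measure_mono_null Set.inter_subset_left h0
  · rw [hr x h0 y, Measure.map_apply hY (measurableSet_singleton _), mul_comm,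
      ProbabilityTheory.cond_mul_eq_inter (hX (measurableSet_singleton _))]

lemma ofReal_condEntropy_eq (X : Ω → S) (Y : Ω → T) (hX : Measurable X)
    (r : S → PMF T) (hr : ∀ x, μ (X ⁻¹' {x}) ≠ 0 →
      ∀ y, r x y = ((ProbabilityTheory.cond μ (X ⁻¹' {x})).map Y) {y}) :
    ENNReal.ofReal (condEntropy Y X μ) =
      ∑ x, μ (X ⁻¹' {x}) * ENNReal.ofReal (∑ y, Real.negMulLog (r x y).toReal) := by
  have h1 : condEntropy Y X μ =
      ∑ x, (μ (X ⁻¹' {x})).toReal * ∑ y, Real.negMulLog (r x y).toReal := by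
    unfold condEntropy entropy
    refine Finset.sum_congr rfl fun x _ => ?_
    rw [Measure.map_apply hX (measurableSet_singleton _)]
    by_cases h0 : μ (X ⁻¹' {x}) = 0
    · simp [h0]
    · simp only [hr x h0]
  rw [h1, ENNReal.ofReal_sum_of_nonneg]
  · refine Finset.sum_congr rfl fun x _ => ?_
    rw [ENNReal.ofReal_mul ENNReal.toReal_nonneg, ENNReal.ofReal_toReal (measure_ne_top _ _)]
  · intro x _
    refine mul_nonneg ENNReal.toReal_nonneg (Finset.sum_nonneg fun y _ => ?_)
    refine Real.negMulLog_nonneg ENNReal.toReal_nonneg ?_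
    simpa using ENNReal.toReal_mono ENNReal.one_ne_top ((r x).coe_le_one y)

end

/-- The infimum of the expected cross-entropy loss over all predictors
`h : 𝒳 → PMF 𝒴` equals the conditional entropy `H(Y | X)`. -/
theorem iInf_crossEntropyLoss_eq_condEntropy
    (μ : Measure Ω) [IsProbabilityMeasure μ]
    {𝒳 : Type*} [Fintype 𝒳] [Nonempty 𝒳] [MeasurableSpace 𝒳] [DiscreteMeasurableSpace 𝒳]
    {𝒴 : Type*} [Fintype 𝒴] [Nonempty 𝒴] [MeasurableSpace 𝒴] [DiscreteMeasurableSpace 𝒴]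
    (X : Ω → 𝒳) (Y : Ω → 𝒴) (hX : Measurable X) (hY : Measurable Y) :
    ⨅ h : 𝒳 → PMF 𝒴, crossEntropyLoss X Y h μ = ENNReal.ofReal (condEntropy Y X μ) := by
  choose r hr using exists_cond_pmf μ X Y hX hY
  rw [ofReal_condEntropy_eq μ X Y hX r hr]
  apply le_antisymm
  · refine (iInf_le _ r).trans ?_
    rw [crossEntropyLoss_eq μ X Y hX hY r r hr]
    simp only [sum_mul_negLog_self, le_refl]
  · refine le_iInf fun h => ?_
    rw [crossEntropyLoss_eq μ X Y hX hY h r hr]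
    gcongr with x
    exact gibbs _ _

end Paper
end

section
/- (Theorem 1 of the paper, cross-entropy form.) Let M ≥ 1 and let X₁, …, X_M and Y be random variables on a common probability space taking values in finite nonempty measurable spaces, with Y valued in 𝒴. For each i let g_i be a measurable map and set Z_i = g_i(X_i), with all Z_i valued in the same finite space, and suppose the features are perfectly aligned: Z₁ = Z₂ = ⋯ = Z_M almost surely. For a random variable W valued in a finite space 𝒲 and a predictor h : 𝒲 → PMF(𝒴), define the expected cross-entropy loss L_W(h) = E[ −log (h(W)) (Y) ] ∈ [0, ∞]. Then inf_h L_{(Z₁,…,Z_M)}(h) − inf_{h'} L_{(X₁,…,X_M)}(h') ≥ Δ_p, where Δ_p = max_{1≤i≤M} I(X_i;Y) − min_{1≤i≤M} I(X_i;Y). -/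
open MeasureTheory ProbabilityTheory Real ENNReal

namespace Paper

variable {Ω : Type*} [MeasurableSpace Ω]

lemma loss_eq {S T : Type*} [Fintype S] [MeasurableSpace S] [DiscreteMeasurableSpace S]
    [Fintype T] [MeasurableSpace T] [DiscreteMeasurableSpace T]
    (μ : Measure Ω) [IsProbabilityMeasure μ] (W : Ω → S) (Y : Ω → T)
    (hW : Measurable W) (hY : Measurable Y) (h : S → PMF T) :
    crossEntropyLoss W Y h μ = ∑ s, ∑ t, (μ (W ⁻¹' {s}) *
      ((ProbabilityTheory.cond μ (W ⁻¹' {s})).map Y {t})) * negLog (h s t) := by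
  have h1 : crossEntropyLoss W Y h μ
      = ∫⁻ p : S × T, negLog (h p.1 p.2) ∂(μ.map (fun ω => (W ω, Y ω))) := by
    rw [lintegral_map (measurable_of_countable _) (hW.prodMk hY)]
    rfl
  rw [h1, lintegral_fintype, Fintype.sum_prod_type]
  refine Finset.sum_congr rfl fun s _ => Finset.sum_congr rfl fun t _ => ?_
  rw [Measure.map_apply (hW.prodMk hY) (measurableSet_singleton _),
    Measure.map_apply hY (measurableSet_singleton _),
    mul_comm (μ _) _, cond_mul_eq_inter (hW (measurableSet_singleton s)), mul_comm]
  congr 2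
  ext ω
  simp [Prod.ext_iff]

lemma negLog_lower (q : ℝ) (hq : 0 ≤ q) (r : ℝ≥0∞) (hr : r ≤ 1) :
    ENNReal.ofReal (Real.negMulLog q + q - r.toReal) ≤ ENNReal.ofReal q * negLog r := by
  rcases hq.eq_or_lt with rfl | hq
  · simp
  by_cases h0 : r = 0
  · subst h0
    simp [negLog, ENNReal.mul_top, hq]
  · have hrpos : 0 < r.toReal := ENNReal.toReal_pos h0 (ne_top_of_le_ne_top one_ne_top hr)
    rw [negLog, if_neg h0, ← ENNReal.ofReal_mul hq.le]
    apply ENNReal.ofReal_le_ofReal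
    have := Real.log_le_sub_one_of_pos (div_pos hrpos hq)
    rw [Real.log_div hrpos.ne' hq.ne'] at this
    have h2 := mul_le_mul_of_nonneg_left this hq.le
    have h3 : q * (r.toReal / q - 1) = r.toReal - q := by field_simp
    rw [h3] at h2
    simp only [Real.negMulLog]
    linarith

lemma ofReal_sum_le' {ι : Type*} (s : Finset ι) (f : ι → ℝ) :
    ENNReal.ofReal (∑ i ∈ s, f i) ≤ ∑ i ∈ s, ENNReal.ofReal (f i) :=
  Finset.le_sum_of_subadditive _ ENNReal.ofReal_zero.le (fun _ _ => ENNReal.ofReal_add_le) _ _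

lemma sum_map_real {T : Type*} [Fintype T] [MeasurableSpace T] [DiscreteMeasurableSpace T]
    (ν : Measure T) [IsProbabilityMeasure ν] : ∑ t, (ν {t}).toReal = 1 := by
  have := sum_measureReal_singleton (μ := ν) (Finset.univ : Finset T)
  simpa [Measure.real] using this

lemma sum_pmf_real {T : Type*} [Fintype T] (p : PMF T) : ∑ t, (p t).toReal = 1 := by
  have h := p.tsum_coe
  rw [tsum_fintype] at h
  rw [← ENNReal.toReal_sum (fun t _ => p.apply_ne_top t), h]
  simp

lemma condEntropy_le_loss {S T : Type*} [Fintype S] [MeasurableSpace S] [DiscreteMeasurableSpace S]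
    [Fintype T] [MeasurableSpace T] [DiscreteMeasurableSpace T]
    (μ : Measure Ω) [IsProbabilityMeasure μ] (W : Ω → S) (Y : Ω → T)
    (hW : Measurable W) (hY : Measurable Y) (h : S → PMF T) :
    ENNReal.ofReal (condEntropy Y W μ) ≤ crossEntropyLoss W Y h μ := by
  rw [loss_eq μ W Y hW hY h, condEntropy]
  refine (ofReal_sum_le' _ _).trans (Finset.sum_le_sum fun s _ => ?_)
  rw [Measure.map_apply hW (measurableSet_singleton _)]
  by_cases hs : μ (W ⁻¹' {s}) = 0
  · simp [hs]
  have := cond_isProbabilityMeasure (μ := μ) hs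
  have := Measure.isProbabilityMeasure_map (μ := μ[|W ⁻¹' {s}]) hY.aemeasurable
  simp only [mul_assoc]
  rw [← Finset.mul_sum, ENNReal.ofReal_mul ENNReal.toReal_nonneg,
    ENNReal.ofReal_toReal (measure_ne_top _ _)]
  gcongr
  have e : entropy Y (μ[|W ⁻¹' {s}]) = ∑ t, (Real.negMulLog ((μ[|W ⁻¹' {s}]).map Y {t}).toReal
      + ((μ[|W ⁻¹' {s}]).map Y {t}).toReal - (h s t).toReal) := by
    rw [Finset.sum_sub_distrib, Finset.sum_add_distrib, sum_map_real, sum_pmf_real, entropy]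
    ring
  rw [e]
  refine (ofReal_sum_le' _ _).trans (Finset.sum_le_sum fun t _ => ?_)
  refine (negLog_lower _ ENNReal.toReal_nonneg _ ((h s).coe_le_one t)).trans ?_
  rw [ENNReal.ofReal_toReal (measure_ne_top _ _)]

lemma entropy_nonneg {T : Type*} [Fintype T] [MeasurableSpace T]
    (ν : Measure Ω) [IsZeroOrProbabilityMeasure ν] (Y : Ω → T) (hY : Measurable Y) :
    0 ≤ entropy Y ν := by
  refine Finset.sum_nonneg fun t _ => Real.negMulLog_nonneg ENNReal.toReal_nonneg ?_
  refine ENNReal.toReal_le_of_le_ofReal zero_le_one ?_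
  rw [ENNReal.ofReal_one]
  refine (measure_mono (Set.subset_univ _)).trans ?_
  rw [Measure.map_apply hY MeasurableSet.univ]
  exact prob_le_one

lemma condEntropy_nonneg {S T : Type*} [Fintype S] [MeasurableSpace S]
    [Fintype T] [MeasurableSpace T]
    (μ : Measure Ω) (W : Ω → S) (Y : Ω → T) (hY : Measurable Y) :
    0 ≤ condEntropy Y W μ :=
  Finset.sum_nonneg fun _ _ => mul_nonneg ENNReal.toReal_nonneg (entropy_nonneg _ Y hY)

lemma exists_loss_le {S T : Type*} [Fintype S] [MeasurableSpace S] [DiscreteMeasurableSpace S]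
    [Fintype T] [Nonempty T] [MeasurableSpace T] [DiscreteMeasurableSpace T]
    (μ : Measure Ω) [IsProbabilityMeasure μ] (W : Ω → S) (Y : Ω → T)
    (hW : Measurable W) (hY : Measurable Y) :
    ∃ h : S → PMF T, crossEntropyLoss W Y h μ ≤ ENNReal.ofReal (condEntropy Y W μ) := by
  have key : ∀ s, ∃ p : PMF T, μ (W ⁻¹' {s}) ≠ 0 →
      ∀ t, p t = (μ[|W ⁻¹' {s}]).map Y {t} := by
    intro s
    by_cases hs : μ (W ⁻¹' {s}) = 0
    · exact ⟨PMF.pure (Classical.arbitrary T), fun h => (h hs).elim⟩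
    · have := cond_isProbabilityMeasure (μ := μ) hs
      have := Measure.isProbabilityMeasure_map (μ := μ[|W ⁻¹' {s}]) hY.aemeasurable
      exact ⟨((μ[|W ⁻¹' {s}]).map Y).toPMF, fun _ t => Measure.toPMF_apply _ _⟩
  choose h hh using key
  refine ⟨h, ?_⟩
  rw [loss_eq μ W Y hW hY h, condEntropy, ENNReal.ofReal_sum_of_nonneg
    (fun _ _ => mul_nonneg ENNReal.toReal_nonneg (entropy_nonneg _ Y hY))]
  refine Finset.sum_le_sum fun s _ => ?_
  rw [Measure.map_apply hW (measurableSet_singleton _)]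
  by_cases hs : μ (W ⁻¹' {s}) = 0
  · simp [hs]
  simp only [mul_assoc]
  rw [← Finset.mul_sum, ENNReal.ofReal_mul ENNReal.toReal_nonneg,
    ENNReal.ofReal_toReal (measure_ne_top _ _)]
  gcongr
  have hle : ∀ t, ((h s) t).toReal ≤ 1 := fun t =>
    ENNReal.toReal_le_of_le_ofReal zero_le_one (by simpa using (h s).coe_le_one t)
  simp only [entropy, ← hh s hs]
  rw [ENNReal.ofReal_sum_of_nonneg
    (fun t _ => Real.negMulLog_nonneg ENNReal.toReal_nonneg (hle t))]
  refine Finset.sum_le_sum fun t _ => ?_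
  by_cases h0 : h s t = 0
  · simp [h0]
  · rw [negLog, if_neg h0, Real.negMulLog, neg_mul_comm, ENNReal.ofReal_mul ENNReal.toReal_nonneg,
      ENNReal.ofReal_toReal ((h s).apply_ne_top t)]

/-- **Theorem 1 of the paper, cross-entropy form.**
If the encoded features `Z i = g i ∘ X i` are perfectly aligned almost surely, then the
optimal expected cross-entropy loss achievable from the aligned representation
`(Z₁, …, Z_M)` exceeds the one achievable from the raw inputs `(X₁, …, X_M)` by at
least `Δ_p = max_i I(X i ; Y) − min_i I(X i ; Y)`, i.e.
`inf_h L_{(Z₁,…,Z_M)}(h) − inf_{h'} L_{(X₁,…,X_M)}(h') ≥ Δ_p`, stated additively in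
`ℝ≥0∞` as `Δ_p + inf_{h'} L_{(X₁,…,X_M)}(h') ≤ inf_h L_{(Z₁,…,Z_M)}(h)`. -/
theorem crossEntropy_gap_of_aligned
    (μ : Measure Ω) [IsProbabilityMeasure μ]
    {M : ℕ} (hM : 1 ≤ M)
    {𝒳 : Fin M → Type*} [∀ i, Fintype (𝒳 i)] [∀ i, Nonempty (𝒳 i)]
    [∀ i, MeasurableSpace (𝒳 i)] [∀ i, DiscreteMeasurableSpace (𝒳 i)]
    {𝒴 : Type*} [Fintype 𝒴] [Nonempty 𝒴] [MeasurableSpace 𝒴] [DiscreteMeasurableSpace 𝒴]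
    {𝒵 : Type*} [Fintype 𝒵] [Nonempty 𝒵] [MeasurableSpace 𝒵] [DiscreteMeasurableSpace 𝒵]
    (X : ∀ i, Ω → 𝒳 i) (Y : Ω → 𝒴) (g : ∀ i, 𝒳 i → 𝒵)
    (hX : ∀ i, Measurable (X i)) (hY : Measurable Y) (hg : ∀ i, Measurable (g i))
    (halign : ∀ i j, (fun ω => g i (X i ω)) =ᵐ[μ] (fun ω => g j (X j ω))) :
    ENNReal.ofReal
        (Finset.univ.sup' ⟨⟨0, hM⟩, Finset.mem_univ _⟩ (fun i => mutualInfo (X i) Y μ)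
          - Finset.univ.inf' ⟨⟨0, hM⟩, Finset.mem_univ _⟩ (fun i => mutualInfo (X i) Y μ))
        + ⨅ h' : (∀ i, 𝒳 i) → PMF 𝒴,
            crossEntropyLoss (fun ω => fun i => X i ω) Y h' μ
      ≤ ⨅ h : (Fin M → 𝒵) → PMF 𝒴,
          crossEntropyLoss (fun ω => fun i => g i (X i ω)) Y h μ := by
  obtain ⟨a, -, ha⟩ := Finset.exists_mem_eq_sup' (s := Finset.univ)
    ⟨⟨0, hM⟩, Finset.mem_univ _⟩ (fun i => mutualInfo (X i) Y μ)
  obtain ⟨b, -, hb⟩ := Finset.exists_mem_eq_inf' (s := Finset.univ)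
    ⟨⟨0, hM⟩, Finset.mem_univ _⟩ (fun i => mutualInfo (X i) Y μ)
  have hab : mutualInfo (X b) Y μ ≤ mutualInfo (X a) Y μ := by
    have := Finset.le_sup' (fun i => mutualInfo (X i) Y μ) (Finset.mem_univ b)
    rw [ha] at this
    exact this
  rw [ha, hb]
  refine le_iInf fun h => ?_
  have hZ : crossEntropyLoss (fun ω => fun i => g i (X i ω)) Y h μ
      = crossEntropyLoss (X b) Y (fun x => h (fun _ => g b x)) μ := by
    refine lintegral_congr_ae ?_
    filter_upwards [ae_all_iff.2 fun i => halign i b] with ω hω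
    have : (fun i => g i (X i ω)) = fun _ => g b (X b ω) := funext hω
    simp only [this]
  rw [hZ]
  refine le_trans ?_ (condEntropy_le_loss μ (X b) Y (hX b) hY _)
  obtain ⟨k, hk⟩ := exists_loss_le μ (X a) Y (hX a) hY
  have hinf : (⨅ h' : (∀ i, 𝒳 i) → PMF 𝒴, crossEntropyLoss (fun ω => fun i => X i ω) Y h' μ)
      ≤ ENNReal.ofReal (condEntropy Y (X a) μ) :=
    (iInf_le _ (fun x : (∀ i, 𝒳 i) => k (x a))).trans hk
  refine (add_le_add le_rfl hinf).trans ?_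
  rw [← ENNReal.ofReal_add (sub_nonneg.2 hab) (condEntropy_nonneg μ (X a) Y hY)]
  apply ENNReal.ofReal_le_ofReal
  simp only [mutualInfo]
  linarith

end Paper
end
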